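/- There is an absolute constant c such that every 2-connected graph G on n vertices has a spanning tree B whose fundamental graph S_B is connected and has diameter at most c·log n. -/

import Mathlib

open Set Function

universe u

/-- `StepsIn step n a b` means that `b` can be obtained from `a` by exactly `n` steps. -/
def StepsIn {X : Type*} (step : X → X → Prop) : ℕ → X → X → Prop
  | 0, a, b => a = b
  | n + 1, a, b => ∃ c, step a c ∧ StepsIn step n c b

variable {V : Type u}

/-- `B` is the edge set of a spanning tree of `G`. -/
def IsSpanningTreeOf (G : SimpleGraph V) (B : Set (Sym2 V)) : Prop :=
  B ⊆ G.edgeSet ∧ (SimpleGraph.fromEdgeSet B).IsTree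

/-- A labelled spanning tree of a graph `G` on `n` vertices, encoded as the injective map
sending each label `i ∈ {1, …, n-1}` to the edge carrying that label; its range must be
the edge set of a spanning tree of `G`. -/
def IsLabelledSpanningTree [Fintype V] (G : SimpleGraph V)
    (b : Fin (Fintype.card V - 1) → Sym2 V) : Prop :=
  Function.Injective b ∧ IsSpanningTreeOf G (Set.range b)

/-- One basis exchange step between labelled spanning trees: the edge carrying label `i`
is replaced by an edge `f` of `G` not in the current tree, `f` receives label `i`, and the
result is again a spanning tree.  All other labels are unchanged. -/
def TreeStep [Fintype V] (G : SimpleGraph V)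
    (b b' : Fin (Fintype.card V - 1) → Sym2 V) : Prop :=
  ∃ (i : Fin (Fintype.card V - 1)) (f : Sym2 V), f ∈ G.edgeSet ∧ f ∉ Set.range b ∧
    IsSpanningTreeOf G (Set.range (Function.update b i f)) ∧ b' = Function.update b i f

/-- Two edges of `G` lie in the same 2-connected component: they are equal or some
cycle of `G` contains both of them. -/
def SameBlock (G : SimpleGraph V) (e f : Sym2 V) : Prop :=
  e = f ∨ ∃ (v : V) (w : G.Walk v v), w.IsCycle ∧ e ∈ w.edges ∧ f ∈ w.edges

/-- `G` is 2-connected: it is connected, has at least 3 vertices, and remains connected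
after the deletion of any single vertex. -/
def TwoConnected [Fintype V] (G : SimpleGraph V) : Prop :=
  3 ≤ Fintype.card V ∧ G.Connected ∧ ∀ v : V, (G.induce {w | w ≠ v}).Connected

/-- The fundamental graph `S_B` of a spanning tree `B` of `G`: vertices are the edges of
`G`, and `e ∈ B` is joined to `f ∈ E(G) \ B` whenever `(B \ {e}) ∪ {f}` is again a
spanning tree of `G`. -/
def treeFundGraph (G : SimpleGraph V) (B : Set (Sym2 V)) : SimpleGraph ↥G.edgeSet :=
  SimpleGraph.fromRel
    (fun e f => e.1 ∈ B ∧ f.1 ∉ B ∧ IsSpanningTreeOf G ((B \ {e.1}) ∪ {f.1}))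

/-- `e` is an edge of `B` lying on a cycle which the non-edge `f` of `B` closes with a path
of `B`. -/
def InFundCycle (G : SimpleGraph V) (B : Set (Sym2 V)) (e f : Sym2 V) : Prop :=
  f ∈ G.edgeSet ∧ f ∉ B ∧ ∃ (x y : V) (p : (SimpleGraph.fromEdgeSet B).Walk x y),
    p.IsPath ∧ f = s(x, y) ∧ e ∈ p.edges

/-- `e` can be reached from `e₀` by at most `d` steps between edges of `B` lying on a common
fundamental cycle. -/
inductive FundDistLE (G : SimpleGraph V) (B : Set (Sym2 V)) (e₀ : Sym2 V) : ℕ → Sym2 V → Prop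
  | base (d : ℕ) : FundDistLE G B e₀ d e₀
  | step {d : ℕ} {e e' f : Sym2 V} : FundDistLE G B e₀ d e' → InFundCycle G B e' f →
      InFundCycle G B e f → FundDistLE G B e₀ (d + 1) e

/-- `B` is the edge set of a tree in `G` with vertex set `S`. -/
structure IsTreeOn (G : SimpleGraph V) (S : Set V) (B : Set (Sym2 V)) : Prop where
  subset_edgeSet : B ⊆ G.edgeSet
  mem_of_mem_edge : ∀ e ∈ B, ∀ v ∈ e, v ∈ S
  isAcyclic : (SimpleGraph.fromEdgeSet B).IsAcyclic
  reachable : ∀ x ∈ S, ∀ y ∈ S, (SimpleGraph.fromEdgeSet B).Reachable x y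

/-- `P` is the vertex set of a path of `G` with both ends in `S`. -/
def IsPathBetween (G : SimpleGraph V) (S P : Set V) : Prop :=
  ∃ a ∈ S, ∃ b ∈ S, ∃ p : G.Walk a b, p.IsPath ∧ P = {z | z ∈ p.support}

section Trees

open SimpleGraph

variable {G : SimpleGraph V} {S S' : Set V} {B B' : Set (Sym2 V)} {e₀ e f : Sym2 V} {d : ℕ}

theorem SimpleGraph.Walk.edges_subset_of_fromEdgeSet {x y : V} (p : (fromEdgeSet B).Walk x y)
    (he : e ∈ p.edges) : e ∈ B := by
  have := p.edges_subset_edgeSet he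
  rw [edgeSet_fromEdgeSet] at this
  exact this.1

theorem SimpleGraph.Walk.IsPath.append_of_inter {x y z : V} {p : G.Walk x y} {q : G.Walk y z}
    (hp : p.IsPath) (hq : q.IsPath) (h : ∀ v ∈ p.support, v ∈ q.support → v = y) :
    (p.append q).IsPath := by
  rw [isPath_def, support_append, List.nodup_append']
  refine ⟨hp.support_nodup, hq.support_nodup.tail, ?_⟩
  intro v hv hv'
  have := h v hv (List.mem_of_mem_tail hv')
  subst this
  have := hq.support_nodup
  rw [← cons_tail_support] at this
  exact (List.nodup_cons.1 this).1 hv'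

theorem InFundCycle.mono (h : InFundCycle G B e f) (hB : B ⊆ B')
    (hac : (fromEdgeSet B').IsAcyclic) : InFundCycle G B' e f := by
  obtain ⟨hf, hfB, x, y, p, hp, rfl, he⟩ := h
  refine ⟨hf, fun hfB' => hfB ?_, x, y, p.mapLe (fromEdgeSet_mono hB), hp.mapLe _, rfl, by
    simpa using he⟩
  have hadj : (fromEdgeSet B').Adj x y := by
    rw [fromEdgeSet_adj]
    exact ⟨hfB', ((G.mem_edgeSet).1 hf).ne⟩
  have := (hac.subsingleton_path x y).elim ⟨p.mapLe (fromEdgeSet_mono hB), hp.mapLe _⟩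
    (Path.singleton hadj)
  have h2 : e ∈ (p.mapLe (fromEdgeSet_mono hB)).edges := by simpa using he
  have h3 : p.mapLe (fromEdgeSet_mono hB) = (Path.singleton hadj : (fromEdgeSet B').Walk x y) :=
    congrArg Subtype.val this
  rw [h3] at h2
  have h4 : e = s(x, y) := by simpa [Path.singleton] using h2
  rw [← h4]
  exact p.edges_subset_of_fromEdgeSet he

theorem FundDistLE.mono (h : FundDistLE G B e₀ d e) (hB : B ⊆ B')
    (hac : (fromEdgeSet B').IsAcyclic) : FundDistLE G B' e₀ d e := by
  induction h with
  | base d => exact .base d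
  | step _ h1 h2 ih => exact .step ih (h1.mono hB hac) (h2.mono hB hac)

theorem FundDistLE.succ (h : FundDistLE G B e₀ d e) : FundDistLE G B e₀ (d + 1) e := by
  induction h with
  | base d => exact .base _
  | step _ h1 h2 ih => exact .step ih h1 h2

theorem IsTreeOn.not_reachable (h : IsTreeOn G S B) {u v : V} (hu : u ∈ S) (hv : v ∉ S) :
    ¬ (fromEdgeSet B).Reachable u v := by
  rintro ⟨p⟩
  have hne : v ≠ u := fun hvu => hv (hvu ▸ hu)
  cases p.reverse with
  | nil => exact hne rfl
  | cons hadj _ => exact hv (h.mem_of_mem_edge _ ((fromEdgeSet_adj _).1 hadj).1 _ (by simp))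

theorem fromEdgeSet_insert_eq_sup_edge (u v : V) :
    fromEdgeSet (insert s(u, v) B) = fromEdgeSet B ⊔ edge u v := by
  rw [edge, Set.insert_eq, fromEdgeSet_union, sup_comm]

theorem IsTreeOn.insert_leaf (h : IsTreeOn G S B) {u v : V} (hu : u ∈ S) (hv : v ∉ S)
    (hadj : G.Adj u v) : IsTreeOn G (insert v S) (insert s(u, v) B) where
  subset_edgeSet := by
    rintro e (rfl | he)
    exacts [hadj, h.subset_edgeSet he]
  mem_of_mem_edge := by
    rintro e (rfl | he) w hw
    · rcases Sym2.mem_iff.1 hw with rfl | rfl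
      exacts [Or.inr hu, Or.inl rfl]
    · exact Or.inr (h.mem_of_mem_edge e he w hw)
  isAcyclic := by
    rw [fromEdgeSet_insert_eq_sup_edge]
    exact h.isAcyclic.sup_edge_of_not_reachable (h.not_reachable hu hv)
  reachable := by
    have key : ∀ x ∈ insert v S,
        (fromEdgeSet (insert s(u, v) B)).Reachable u x := by
      rintro x (rfl | hx)
      · exact Adj.reachable ((fromEdgeSet_adj _).2 ⟨Or.inl rfl, hadj.ne⟩)
      · exact (h.reachable u hu x hx).mono (fromEdgeSet_mono (Set.subset_insert _ _))
    exact fun x hx y hy => (key x hx).symm.trans (key y hy)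

theorem IsTreeOn.union_path {a v : V} (p : G.Walk a v) : ∀ {S : Set V} {B : Set (Sym2 V)},
    IsTreeOn G S B → p.IsPath → a ∈ S → (∀ z ∈ p.support, z ≠ a → z ∉ S) →
    IsTreeOn G (S ∪ {z | z ∈ p.support}) (B ∪ {e | e ∈ p.edges}) := by
  induction p with
  | nil =>
    intro S B h _ ha _
    simpa [Set.insert_eq_of_mem ha] using h
  | @cons a w v hadj q ih =>
    intro S B h hp ha hS
    rw [Walk.cons_isPath_iff] at hp
    have hwa : w ≠ a := hadj.ne'
    have hw : w ∉ S := hS w (by simp) hwa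
    have := ih (h.insert_leaf ha hw hadj) hp.1 (by simp) (by
      intro z hz hzw
      rintro (rfl | hzS)
      · exact hzw rfl
      · exact hS z (by simp [hz]) (fun hza => hp.2 (hza ▸ hz)) hzS)
    convert! this using 1
    · ext z
      have : w ∈ q.support := q.start_mem_support
      simp only [Set.mem_union, Walk.support_cons, List.mem_cons, Set.mem_ofPred_eq,
        Set.mem_insert_iff]
      grind
    · ext e
      simp only [Set.mem_union, Walk.edges_cons, List.mem_cons, Set.mem_ofPred_eq,
        Set.mem_insert_iff]
      tauto

theorem IsTreeOn.support_subset (h : IsTreeOn G S B) {x y : V} (p : (fromEdgeSet B).Walk x y)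
    (hx : x ∈ S) : ∀ z ∈ p.support, z ∈ S := by
  intro z hz
  by_contra hzS
  obtain ⟨q, _, _⟩ := Walk.mem_support_iff_exists_append.1 hz
  exact h.not_reachable hx hzS ⟨q⟩

/-- Adding to a tree all but the last edge of a path whose two distinct ends lie in a subtree. -/
theorem IsTreeOn.exists_union_ear (h : IsTreeOn G S B) (hd : ∀ e ∈ B, FundDistLE G B e₀ d e)
    (h' : IsTreeOn G S' B') (hd' : ∀ e ∈ B', FundDistLE G B' e₀ (d + 1) e)
    (hS : S ⊆ S') (hB : B ⊆ B') {a v b : V} (p : G.Walk a v) (hp : p.IsPath) (ha : a ∈ S)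
    (hpS : ∀ z ∈ p.support, z ≠ a → z ∉ S') (hadj : G.Adj v b) (hb : b ∈ S) (hba : b ≠ a) :
    ∃ B'', B' ⊆ B'' ∧ IsTreeOn G (S' ∪ {z | z ∈ p.support}) B'' ∧
      ∀ e ∈ B'', FundDistLE G B'' e₀ (d + 1) e := by
  have hT := IsTreeOn.union_path p h' hp (hS ha) hpS
  have hsub : B' ⊆ B' ∪ {e | e ∈ p.edges} := Set.subset_union_left
  refine ⟨_, hsub, hT, ?_⟩
  rintro e (he | he)
  · exact (hd' e he).mono hsub hT.isAcyclic
  obtain ⟨q, hq⟩ := (h.reachable a ha b hb).exists_isPath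
  have hqS := h.support_subset q ha
  have hqe : ∃ e', e' ∈ q.edges := by
    cases q with
    | nil => exact absurd rfl hba
    | cons hadj q => exact ⟨_, List.mem_cons_self⟩
  obtain ⟨e', he'⟩ := hqe
  have hva : v ≠ a := by
    rintro rfl
    rw [(Walk.isPath_iff_nil.1 hp).eq_nil] at he
    simp at he
  have hvS' : v ∉ S' := hpS v p.end_mem_support hva
  have hpT : ∀ e ∈ p.edges, e ∈ (fromEdgeSet (B' ∪ {e | e ∈ p.edges})).edgeSet := by
    intro e he
    rw [edgeSet_fromEdgeSet]
    exact ⟨Or.inr he, fun hdiag => G.not_isDiag_of_mem_edgeSet (p.edges_subset_edgeSet he) hdiag⟩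
  have hqT : fromEdgeSet B ≤ fromEdgeSet (B' ∪ {e | e ∈ p.edges}) :=
    fromEdgeSet_mono (hB.trans hsub)
  have hf : s(v, b) ∉ B' ∪ {e | e ∈ p.edges} := by
    rintro (hf | hf)
    · exact hvS' (h'.mem_of_mem_edge _ hf v (by simp))
    · exact hpS b (p.snd_mem_support_of_mem_edges hf) hba (hS hb)
  have hpath : ((p.transfer _ hpT).reverse.append (q.mapLe hqT)).IsPath := by
    refine (hp.transfer hpT).reverse.append_of_inter (hq.mapLe hqT) ?_
    intro z hz hz'
    by_contra hza
    refine hpS z (by simpa using hz) hza (hS (hqS z (by simpa using hz')))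
  have hcyc : ∀ e, (e ∈ p.edges ∨ e ∈ q.edges) →
      InFundCycle G (B' ∪ {e | e ∈ p.edges}) e s(v, b) := fun e he =>
    ⟨hadj, hf, v, b, _, hpath, rfl, by simpa using he⟩
  exact .step ((hd e' (q.edges_subset_of_fromEdgeSet he')).mono (hB.trans hsub) hT.isAcyclic)
    (hcyc e' (Or.inr he')) (hcyc e (Or.inl he))

theorem IsTreeOn.exists_union_append (h : IsTreeOn G S B) (hd : ∀ e ∈ B, FundDistLE G B e₀ d e)
    {v b : V} (hb : b ∈ S) (q : G.Walk v b) : ∀ {S' : Set V} {B' : Set (Sym2 V)} {a : V}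
    (p : G.Walk a v), IsTreeOn G S' B' → (∀ e ∈ B', FundDistLE G B' e₀ (d + 1) e) →
    S ⊆ S' → B ⊆ B' → (p.append q).IsPath → a ∈ S → (∀ z ∈ p.support, z ≠ a → z ∉ S') →
    (∀ z ∈ q.support, z ∈ S' → z ∈ S) →
    ∃ B'', B' ⊆ B'' ∧ IsTreeOn G (S' ∪ {z | z ∈ (p.append q).support}) B'' ∧
      ∀ e ∈ B'', FundDistLE G B'' e₀ (d + 1) e := by
  induction q with
  | @nil b =>
    intro S' B' a p h' hd' hS hB hp ha hpS _
    obtain rfl : b = a := by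
      by_contra hba
      exact hpS b p.end_mem_support hba (hS hb)
    refine ⟨B', subset_rfl, ?_, hd'⟩
    rw [Walk.append_nil] at hp ⊢
    rw [(Walk.isPath_iff_nil.1 hp).eq_nil]
    simpa [Set.insert_eq_of_mem (hS ha)] using h'
  | @cons v w b hadj q ih =>
    intro S' B' a p h' hd' hS hB hp ha hpS hqS
    have hp' : ((p.concat hadj).append q).IsPath := by rwa [Walk.concat_append]
    have hpw := (Walk.concat_isPath_iff hadj).1 hp'.of_append_left
    by_cases hw : w ∈ S
    · obtain ⟨B₁, hB₁, hT₁, hd₁⟩ := h.exists_union_ear hd h' hd' hS hB p hpw.1 ha hpS hadj hw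
        (fun hwa => hpw.2 (hwa ▸ p.start_mem_support))
      obtain ⟨B₂, hB₂, hT₂, hd₂⟩ := ih hb Walk.nil hT₁ hd₁ (hS.trans Set.subset_union_left)
        (hB.trans hB₁) (by simpa using hp'.of_append_right) hw (by simp) (by
          rintro z hz (hz' | hz')
          · exact hqS z (by simp [hz]) hz'
          · by_contra hzS
            have hnd := hp.support_nodup
            rw [Walk.support_append, List.nodup_append'] at hnd
            exact hnd.2.2 hz' (by simpa using hz))
      refine ⟨B₂, hB₁.trans hB₂, ?_, hd₂⟩
      convert! hT₂ using 1
      ext z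
      have := p.end_mem_support
      simp only [Set.mem_union, Set.mem_ofPred_eq, Walk.mem_support_append_iff,
        Walk.support_cons, List.mem_cons, Walk.nil_append]
      grind
    · have hw' : w ∉ S' := fun hwS' => hw (hqS w (by simp) hwS')
      rw [← Walk.concat_append]
      refine ih hb (p.concat hadj) h' hd' hS hB hp' ha ?_ ?_
      · intro z hz hza
        rw [Walk.support_concat, List.mem_append, List.mem_singleton] at hz
        rcases hz with hz | rfl
        exacts [hpS z hz hza, hw']
      · exact fun z hz => hqS z (by simp [hz])

/-- A tree can absorb a family of paths which have their ends in the tree and are disjoint outside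
of it, increasing the distances to `e₀` by one step only. -/
theorem IsTreeOn.exists_biUnion_paths (h : IsTreeOn G S B)
    (hd : ∀ e ∈ B, FundDistLE G B e₀ d e) {ι : Type*} (t : Finset ι) (P : ι → Set V)
    (hP : ∀ i ∈ t, IsPathBetween G S (P i))
    (hdisj : ∀ i ∈ t, ∀ j ∈ t, i ≠ j → P i ∩ P j ⊆ S) :
    ∃ B', B ⊆ B' ∧ IsTreeOn G (S ∪ ⋃ i ∈ t, P i) B' ∧ ∀ e ∈ B', FundDistLE G B' e₀ (d + 1) e := by
  classical
  induction t using Finset.induction_on with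
  | empty => exact ⟨B, subset_rfl, by simpa using h, fun e he => (hd e he).succ⟩
  | @insert i t hi ih =>
    obtain ⟨B₁, hB₁, hT₁, hd₁⟩ := ih (fun j hj => hP j (by simp [hj]))
      (fun j hj k hk => hdisj j (by simp [hj]) k (by simp [hk]))
    obtain ⟨a, ha, b, hb, p, hp, hPi⟩ := hP i (by simp)
    obtain ⟨B₂, hB₂, hT₂, hd₂⟩ := h.exists_union_append hd hb p Walk.nil hT₁ hd₁
      Set.subset_union_left hB₁ (by simpa using hp) ha (by simp) (by
        rintro z hz (hzS | hzU)
        · exact hzS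
        · simp only [Set.mem_iUnion] at hzU
          obtain ⟨j, hj, hzj⟩ := hzU
          exact hdisj i (by simp) j (by simp [hj]) (fun hij => hi (hij ▸ hj))
            ⟨hPi ▸ hz, hzj⟩)
    refine ⟨B₂, hB₁.trans hB₂, ?_, hd₂⟩
    rw [Walk.nil_append, ← hPi] at hT₂
    rwa [Finset.set_biUnion_insert, Set.union_comm (P i), ← Set.union_assoc]

theorem InFundCycle.isSpanningTreeOf (h : IsTreeOn G Set.univ B) (hef : InFundCycle G B e f) :
    IsSpanningTreeOf G ((B \ {e}) ∪ {f}) := by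
  obtain ⟨hf, hfB, x, y, p, hp, rfl, he⟩ := hef
  have heB := p.edges_subset_of_fromEdgeSet he
  have hxy : x ≠ y := ((G.mem_edgeSet).1 hf).ne
  have hdel : fromEdgeSet (B \ {e}) = (fromEdgeSet B).deleteEdges {e} := by
    ext a b
    simp
  have hEq : fromEdgeSet ((B \ {e}) ∪ {s(x, y)}) = fromEdgeSet (B \ {e}) ⊔ edge x y := by
    rw [edge, fromEdgeSet_union]
  refine ⟨Set.union_subset (Set.sdiff_subset.trans h.subset_edgeSet)
    (Set.singleton_subset_iff.2 hf), ?_, ?_⟩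
  · obtain ⟨u, v⟩ := e
    have hconn : (fromEdgeSet B ⊔ edge x y).Connected := by
      refine (connected_iff_exists_forall_reachable _).2 ⟨x, fun w => ?_⟩
      exact (h.reachable x trivial w trivial).mono le_sup_left
    have hcyc : ¬ (fromEdgeSet B ⊔ edge x y).IsBridge s(u, v) := by
      have hadj : (fromEdgeSet B ⊔ edge x y).Adj y x := by
        right; simp [edge_adj, hxy.symm]
      intro hb
      refine hb.notMem_edges_of_isCycle (p := Walk.cons hadj (p.mapLe le_sup_left)) ?_ (by
        simp [he])
      rw [Walk.cons_isCycle_iff]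
      refine ⟨hp.mapLe _, fun hmem => hfB ?_⟩
      rw [Walk.edges_mapLe_eq_edges, Sym2.eq_swap] at hmem
      exact p.edges_subset_of_fromEdgeSet hmem
    have := hconn.connected_delete_edge_of_not_isBridge hcyc
    rw [hEq]
    refine this.mono ?_
    rw [deleteEdges_sup]
    exact sup_le_sup hdel.ge (deleteEdges_le _)
  · rw [hEq]
    refine IsAcyclic.sup_edge_of_not_reachable ?_
      (h.isAcyclic.anti (fromEdgeSet_mono Set.sdiff_subset))
    intro hr
    obtain ⟨q, hq⟩ := hr.exists_isPath
    have hle : fromEdgeSet (B \ {e}) ≤ fromEdgeSet B := fromEdgeSet_mono Set.sdiff_subset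
    have := (h.isAcyclic.subsingleton_path x y).elim ⟨p, hp⟩ ⟨q.mapLe hle, hq.mapLe hle⟩
    have hpq : p = q.mapLe hle := congrArg Subtype.val this
    rw [hpq, Walk.edges_mapLe_eq_edges] at he
    exact (q.edges_subset_of_fromEdgeSet he).2 rfl

theorem InFundCycle.adj (h : IsTreeOn G Set.univ B) (hef : InFundCycle G B e f)
    (he : e ∈ G.edgeSet) (hf : f ∈ G.edgeSet) : (treeFundGraph G B).Adj ⟨e, he⟩ ⟨f, hf⟩ := by
  have hsp := hef.isSpanningTreeOf h
  obtain ⟨-, hfB, x, y, p, -, rfl, hep⟩ := hef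
  have heB := p.edges_subset_of_fromEdgeSet hep
  rw [treeFundGraph, fromRel_adj]
  refine ⟨?_, Or.inl ⟨heB, hfB, hsp⟩⟩
  intro heq
  have hval : e = s(x, y) := congrArg Subtype.val heq
  exact hfB (hval ▸ heB)

theorem FundDistLE.exists_walk (h : IsTreeOn G Set.univ B) (he₀ : e₀ ∈ G.edgeSet)
    (hde : FundDistLE G B e₀ d e) : ∀ he : e ∈ G.edgeSet,
    ∃ w : (treeFundGraph G B).Walk ⟨e₀, he₀⟩ ⟨e, he⟩, w.length ≤ 2 * d := by
  induction hde with
  | base d => exact fun _ => ⟨Walk.nil, by simp⟩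
  | @step d e e' f _ h1 h2 ih =>
    intro he
    have he' : e' ∈ G.edgeSet := by
      obtain ⟨-, -, x, y, p, -, -, hep⟩ := h1
      exact h.subset_edgeSet (p.edges_subset_of_fromEdgeSet hep)
    obtain ⟨w, hw⟩ := ih he'
    refine ⟨(w.concat (h1.adj h he' h1.1)).concat (h2.adj h he h1.1).symm, ?_⟩
    simp only [Walk.length_concat]
    lia

theorem IsTreeOn.exists_inFundCycle (h : IsTreeOn G Set.univ B) (hf : f ∈ G.edgeSet)
    (hfB : f ∉ B) : ∃ e ∈ B, InFundCycle G B e f := by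
  obtain ⟨x, y⟩ := f
  obtain ⟨p, hp⟩ := (h.reachable x trivial y trivial).exists_isPath
  have hxy : x ≠ y := ((G.mem_edgeSet).1 hf).ne
  obtain ⟨e, he⟩ : ∃ e, e ∈ p.edges := by
    cases p with
    | nil => exact absurd rfl hxy
    | cons hadj p => exact ⟨_, List.mem_cons_self⟩
  exact ⟨e, p.edges_subset_of_fromEdgeSet he, hf, hfB, x, y, p, hp, rfl, he⟩

theorem IsTreeOn.exists_walk (h : IsTreeOn G Set.univ B) (hd : ∀ e ∈ B, FundDistLE G B e₀ d e)
    (he₀ : e₀ ∈ G.edgeSet) (f : G.edgeSet) :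
    ∃ w : (treeFundGraph G B).Walk ⟨e₀, he₀⟩ f, w.length ≤ 2 * d + 1 := by
  obtain ⟨f, hf⟩ := f
  by_cases hfB : f ∈ B
  · obtain ⟨w, hw⟩ := (hd f hfB).exists_walk h he₀ hf
    exact ⟨w, by lia⟩
  · obtain ⟨e, heB, hef⟩ := h.exists_inFundCycle hf hfB
    have he := h.subset_edgeSet heB
    obtain ⟨w, hw⟩ := (hd e heB).exists_walk h he₀ he
    exact ⟨w.concat (hef.adj h he hf), by simpa using hw⟩

end Trees

/-- The vertex set of the connected component of `x` in `G` with the vertices in `S` deleted. -/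
def avoidComp (G : SimpleGraph V) (S : Set V) (x : V) : Set V :=
  {y | ∃ p : G.Walk x y, ∀ z ∈ p.support, z ∉ S}

section Separation

open SimpleGraph

variable {G : SimpleGraph V} {S S' : Set V} {x y z : V}

theorem self_mem_avoidComp (hx : x ∉ S) : x ∈ avoidComp G S x :=
  ⟨Walk.nil, by simpa using hx⟩

theorem notMem_of_mem_avoidComp (h : y ∈ avoidComp G S x) : y ∉ S := by
  obtain ⟨p, hp⟩ := h
  exact hp y p.end_mem_support

theorem mem_avoidComp_symm (h : y ∈ avoidComp G S x) : x ∈ avoidComp G S y := by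
  obtain ⟨p, hp⟩ := h
  exact ⟨p.reverse, by simpa using hp⟩

theorem mem_avoidComp_trans (h : y ∈ avoidComp G S x) (h' : z ∈ avoidComp G S y) :
    z ∈ avoidComp G S x := by
  obtain ⟨p, hp⟩ := h
  obtain ⟨q, hq⟩ := h'
  refine ⟨p.append q, fun w hw => ?_⟩
  rcases (Walk.mem_support_append_iff _ _).1 hw with hw | hw
  exacts [hp w hw, hq w hw]

theorem avoidComp_eq_of_mem (h : y ∈ avoidComp G S x) : avoidComp G S y = avoidComp G S x :=
  Set.Subset.antisymm (fun _ hz => mem_avoidComp_trans h hz)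
    (fun _ hz => mem_avoidComp_trans (mem_avoidComp_symm h) hz)

theorem avoidComp_anti (hS : S ⊆ S') : avoidComp G S' x ⊆ avoidComp G S x :=
  fun _ ⟨p, hp⟩ => ⟨p, fun z hz hzS => hp z hz (hS hzS)⟩

theorem SimpleGraph.Adj.mem_avoidComp (h : G.Adj x y) (hx : x ∉ S) (hy : y ∉ S) :
    y ∈ avoidComp G S x :=
  ⟨h.toWalk, by simp [hx, hy]⟩

theorem exists_adj_mem_avoidComp {w s : V} (p : G.Walk w s) : w ∉ S → s ∈ S →
    ∃ u ∈ avoidComp G S w, ∃ a ∈ S, a ∈ p.support ∧ G.Adj a u := by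
  induction p with
  | nil => exact fun hw hs => absurd hs hw
  | @cons w w' s hadj p ih =>
    intro hw hs
    by_cases hw' : w' ∈ S
    · exact ⟨w, self_mem_avoidComp hw, w', hw', by simp, hadj.symm⟩
    · obtain ⟨u, hu, a, ha, hap, hau⟩ := ih hw' hs
      exact ⟨u, mem_avoidComp_trans (hadj.mem_avoidComp hw hw') hu, a, ha, by simp [hap], hau⟩

theorem exists_isPath_first_hit {T : Set V} {y s : V} (p : G.Walk y s) : s ∈ T →
    ∃ r ∈ T, ∃ q : G.Walk y r, q.IsPath ∧ (∀ z ∈ q.support, z ∈ p.support) ∧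
      ∀ z ∈ q.support, z ≠ r → z ∉ T := by
  classical
  intro hs
  suffices ∃ r ∈ T, ∃ q : G.Walk y r, (∀ z ∈ q.support, z ∈ p.support) ∧
      ∀ z ∈ q.support, z ≠ r → z ∉ T by
    obtain ⟨r, hr, q, h1, h2⟩ := this
    exact ⟨r, hr, q.bypass, q.bypass_isPath, fun z hz => h1 z (q.support_bypass_subset_support hz),
      fun z hz => h2 z (q.support_bypass_subset_support hz)⟩
  induction p with
  | @nil y => exact ⟨y, hs, Walk.nil, by simp, by simp⟩
  | @cons y w s hadj p ih =>
    by_cases hy : y ∈ T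
    · exact ⟨y, hy, Walk.nil, by simp, by simp⟩
    · obtain ⟨r, hr, q, h1, h2⟩ := ih hs
      refine ⟨r, hr, Walk.cons hadj q, ?_, ?_⟩
      · simp only [Walk.support_cons, List.mem_cons]
        rintro z (rfl | hz)
        exacts [Or.inl rfl, Or.inr (h1 z hz)]
      · simp only [Walk.support_cons, List.mem_cons]
        rintro z (rfl | hz) hzr
        exacts [hy, h2 z hz hzr]

theorem SimpleGraph.Walk.IsPath.exists_takeUntil_disjoint {s v t r : V} {p : G.Walk s v}
    {q : G.Walk v t} (h : (p.append q).IsPath) (hr : r ∈ p.support) (hrv : r ≠ v) :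
    ∃ p' : G.Walk s r, p'.IsPath ∧ (∀ z ∈ p'.support, z ∈ p.support) ∧
      ∀ z ∈ p'.support, z ∉ q.support := by
  classical
  have hp := h.of_append_left
  refine ⟨p.takeUntil r hr, hp.takeUntil hr, fun z hz => p.support_takeUntil_subset_support hr hz,
    fun z hz hzq => ?_⟩
  have hzv : z ≠ v := by
    rintro rfl
    exact Walk.endpoint_notMem_support_takeUntil hp hr hrv.symm hz
  exact h.ne_of_mem_support_of_append hzv (p.support_takeUntil_subset_support hr hz) hzq rfl

theorem exists_walk_of_induce {U : Set V} {a b : U} (p : (G.induce U).Walk a b) :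
    ∃ q : G.Walk a b, ∀ z ∈ q.support, z ∈ U := by
  induction p with
  | @nil a => exact ⟨Walk.nil, by simp⟩
  | @cons a _ _ hadj p ih =>
    obtain ⟨q, hq⟩ := ih
    have hadj' : G.Adj a.1 _ := induce_adj.1 hadj
    refine ⟨Walk.cons hadj' q, ?_⟩
    simp only [Walk.support_cons, List.mem_cons]
    rintro z (rfl | hz)
    exacts [a.2, hq z hz]

/-- The heart of the fan lemma: if a path with ends in `S` passes through `v`, then another one
passes through the neighbour `y` of `v`. -/
theorem exists_isPathBetween_of_adj (h2 : ∀ v : V, (G.induce {w | w ≠ v}).Connected)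
    (hS : S.Nontrivial) {v : V} {P : Set V} (hP : IsPathBetween G S P) (hv : v ∈ P)
    (hPK : P ⊆ avoidComp G S x ∪ S) (hadj : G.Adj v y) (hy : y ∈ avoidComp G S x ∪ S) :
    ∃ P', IsPathBetween G S P' ∧ y ∈ P' ∧ P' ⊆ avoidComp G S x ∪ S := by
  by_cases hyP : y ∈ P
  · exact ⟨P, hP, hyP, hPK⟩
  by_cases hyS : y ∈ S
  · exact ⟨{y}, ⟨y, hyS, y, hyS, Walk.nil, by simp, by ext; simp⟩, rfl, by
      rintro _ rfl; exact Or.inr hyS⟩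
  have hyK : y ∈ avoidComp G S x := hy.resolve_right hyS
  obtain ⟨s, hs, t, ht, p₀, hp₀, rfl⟩ := hP
  obtain ⟨s', hs', hs'v⟩ := hS.exists_ne v
  obtain ⟨R₀, hR₀⟩ : ∃ R : G.Walk y s', v ∉ R.support := by
    obtain ⟨R⟩ := (h2 v).preconnected ⟨y, hadj.ne'⟩ ⟨s', hs'v⟩
    obtain ⟨R', hR'⟩ := exists_walk_of_induce R
    exact ⟨R', fun hv => hR' v hv rfl⟩
  obtain ⟨r, hr, R, hR, hRR₀, hRT⟩ :=
    exists_isPath_first_hit (T := S ∪ {z | z ∈ p₀.support}) R₀ (Or.inl hs')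
  have hrv : r ≠ v := fun hrv => hR₀ (hrv ▸ hRR₀ r R.end_mem_support)
  obtain ⟨p, q, rfl⟩ := Walk.mem_support_iff_exists_append.1 hv
  obtain ⟨s₁, hs₁, t₁, ht₁, p', q', hp', hq', hp'sub, hq'sub, hpq'⟩ : ∃ s₁ ∈ S, ∃ t₁ ∈ S,
      ∃ (p' : G.Walk s₁ r) (q' : G.Walk v t₁), p'.IsPath ∧ q'.IsPath ∧
      (∀ z ∈ p'.support, z = r ∨ z ∈ (p.append q).support) ∧
      (∀ z ∈ q'.support, z ∈ (p.append q).support) ∧ ∀ z ∈ p'.support, z ∉ q'.support := by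
    by_cases hrP : r ∈ (p.append q).support
    · rcases (Walk.mem_support_append_iff _ _).1 hrP with hrp | hrq
      · obtain ⟨p', hp', h1, h2⟩ := hp₀.exists_takeUntil_disjoint hrp hrv
        exact ⟨s, hs, t, ht, p', q, hp', hp₀.of_append_right, fun z hz => Or.inr (by simp [h1 z hz]),
          fun z hz => by simp [hz], h2⟩
      · have hrev := hp₀.reverse
        rw [Walk.reverse_append] at hrev
        obtain ⟨p', hp', h1, h2⟩ := hrev.exists_takeUntil_disjoint (by simpa using hrq) hrv
        exact ⟨t, ht, s, hs, p', p.reverse, hp', hrev.of_append_right,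
          fun z hz => Or.inr (by have := h1 z hz; simp at this; simp [this]),
          fun z hz => by simp at hz; simp [hz], h2⟩
    · refine ⟨r, hr.resolve_right hrP, t, ht, Walk.nil, q, by simp, hp₀.of_append_right,
        fun z hz => Or.inl (by simpa using hz), fun z hz => by simp [hz], ?_⟩
      simp only [Walk.support_nil, List.mem_singleton]
      rintro z rfl hzq
      exact hrP (by simp [hzq])
  have hRK : ∀ z ∈ R.support, z ∈ avoidComp G S x ∪ S := by
    have hr' : r ∈ avoidComp G S x ∪ S := by
      rcases hr with hr | hr
      exacts [Or.inr hr, hPK hr]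
    intro z hz
    by_cases hzr : z = r
    · exact hzr ▸ hr'
    · left
      obtain ⟨R₁, R₂, rfl⟩ := Walk.mem_support_iff_exists_append.1 hz
      refine mem_avoidComp_trans hyK ⟨R₁, fun w hw hwS => ?_⟩
      have hwr : w = r := by
        by_contra hwr
        exact hRT w (by simp [hw]) hwr (Or.inl hwS)
      exact hR.ne_of_mem_support_of_append (Ne.symm hzr) (hwr ▸ hw) R₂.end_mem_support rfl
  have hpR : (p'.append R.reverse).IsPath := by
    refine hp'.append_of_inter hR.reverse fun z hz hzR => ?_
    by_contra hzr
    exact hRT z (by simpa using hzR) hzr (Or.inr ((hp'sub z hz).resolve_left hzr))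
  have hyq : (Walk.cons hadj.symm q').IsPath :=
    (Walk.cons_isPath_iff _ _).2 ⟨hq', fun hyq' => hyP (hq'sub y hyq')⟩
  have hfull : ((p'.append R.reverse).append (Walk.cons hadj.symm q')).IsPath := by
    refine hpR.append_of_inter hyq fun z hz hz' => ?_
    rw [Walk.support_cons, List.mem_cons] at hz'
    refine hz'.resolve_right fun hzq => ?_
    rcases (Walk.mem_support_append_iff _ _).1 hz with hz | hz
    · exact hpq' z hz hzq
    · have hzr : z = r := by
        by_contra hzr
        exact hRT z (by simpa using hz) hzr (Or.inr (hq'sub z hzq))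
      exact hpq' r p'.end_mem_support (hzr ▸ hzq)
  refine ⟨_, ⟨s₁, hs₁, t₁, ht₁, _, hfull, rfl⟩, by simp, ?_⟩
  intro z hz
  simp only [Set.mem_ofPred_eq, Walk.mem_support_append_iff, Walk.support_cons, List.mem_cons,
    Walk.support_reverse, List.mem_reverse] at hz
  rcases hz with (hz | hz) | rfl | hz
  · rcases hp'sub z hz with rfl | hz
    exacts [hRK _ R.end_mem_support, hPK hz]
  · exact hRK z hz
  · exact hy
  · exact hPK (hq'sub z hz)

theorem exists_isPathBetween_of_walk (h2 : ∀ v : V, (G.induce {w | w ≠ v}).Connected)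
    (hS : S.Nontrivial) {a v : V} (q : G.Walk a v)
    (ha : ∃ P, IsPathBetween G S P ∧ a ∈ P ∧ P ⊆ avoidComp G S x ∪ S)
    (hq : ∀ z ∈ q.support, z ∈ avoidComp G S x ∪ S) :
    ∃ P, IsPathBetween G S P ∧ v ∈ P ∧ P ⊆ avoidComp G S x ∪ S := by
  induction q with
  | nil => exact ha
  | cons hadj q ih =>
    obtain ⟨P, hP, haP, hPK⟩ := ha
    exact ih (exists_isPathBetween_of_adj h2 hS hP haP hPK hadj (hq _ (by simp)))
      (fun z hz => hq z (by simp [hz]))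

theorem exists_isPath_extend_halving [Finite V] (n : ℕ) : ∀ {a v y : V} (q : G.Walk a v),
    q.IsPath → (∀ z ∈ q.support, z ∈ avoidComp G S x ∪ S) → y ∈ avoidComp G S x →
    (∃ z ∈ avoidComp G (S ∪ {z | z ∈ q.support}) y, G.Adj v z) →
    (avoidComp G (S ∪ {z | z ∈ q.support}) y).ncard ≤ n →
    (avoidComp G S x).ncard < 2 * (avoidComp G (S ∪ {z | z ∈ q.support}) y).ncard →
    ∃ (v' : V) (q' : G.Walk a v'), q'.IsPath ∧ (∀ z ∈ q'.support, z ∈ avoidComp G S x ∪ S) ∧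
      ∀ y ∈ avoidComp G S x, y ∉ q'.support →
        2 * (avoidComp G (S ∪ {z | z ∈ q'.support}) y).ncard ≤ (avoidComp G S x).ncard := by
  induction n with
  | zero => intro a v y q _ _ _ _ h1 h2; lia
  | succ n ih =>
    intro a v y q hq hqK hy hz hn hbig
    obtain ⟨z, hz, hvz⟩ := hz
    have hLK : avoidComp G (S ∪ {z | z ∈ q.support}) y ⊆ avoidComp G S x :=
      (avoidComp_anti Set.subset_union_left).trans (avoidComp_eq_of_mem hy).subset
    have hzS := notMem_of_mem_avoidComp hz
    have hq' : (q.concat hvz).IsPath := hq.concat (fun h => hzS (Or.inr h)) hvz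
    have hsupp : S ∪ {w | w ∈ (q.concat hvz).support} = insert z (S ∪ {w | w ∈ q.support}) := by
      ext w
      simp only [Walk.support_concat, List.mem_append, List.mem_singleton,
        Set.mem_union, Set.mem_ofPred_eq, Set.mem_insert_iff]
      tauto
    have hqK' : ∀ w ∈ (q.concat hvz).support, w ∈ avoidComp G S x ∪ S := by
      intro w hw
      rw [Walk.support_concat, List.mem_append, List.mem_singleton] at hw
      rcases hw with hw | rfl
      exacts [hqK w hw, Or.inl (hLK hz)]
    by_contra hcon
    have hcon' : ∃ y' ∈ avoidComp G S x, y' ∉ (q.concat hvz).support ∧ (avoidComp G S x).ncard <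
        2 * (avoidComp G (S ∪ {w | w ∈ (q.concat hvz).support}) y').ncard := by
      by_contra! hall
      exact hcon ⟨z, q.concat hvz, hq', hqK', hall⟩
    obtain ⟨y', hy', hy'q, hbig'⟩ := hcon'
    have hL'K : avoidComp G (S ∪ {w | w ∈ (q.concat hvz).support}) y' ⊆ avoidComp G S x :=
      (avoidComp_anti Set.subset_union_left).trans (avoidComp_eq_of_mem hy').subset
    obtain ⟨w, hwL, hwL'⟩ : (avoidComp G (S ∪ {z | z ∈ q.support}) y ∩
        avoidComp G (S ∪ {w | w ∈ (q.concat hvz).support}) y').Nonempty := by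
      rw [← Set.not_disjoint_iff_nonempty_inter]
      intro hdisj
      have h1 := Set.ncard_union_eq hdisj (Set.toFinite _) (Set.toFinite _)
      have h2 := Set.ncard_le_ncard (Set.union_subset hLK hL'K) (Set.toFinite _)
      lia
    have hL'L : avoidComp G (S ∪ {w | w ∈ (q.concat hvz).support}) y' ⊆
        avoidComp G (S ∪ {z | z ∈ q.support}) y := by
      rw [← avoidComp_eq_of_mem hwL', ← avoidComp_eq_of_mem hwL]
      exact avoidComp_anti (hsupp ▸ Set.subset_insert _ _)
    have hzL' : z ∉ avoidComp G (S ∪ {w | w ∈ (q.concat hvz).support}) y' :=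
      fun h => notMem_of_mem_avoidComp h (Or.inr (by simp))
    have hlt := Set.ncard_lt_ncard ⟨hL'L, fun h => hzL' (h hz)⟩
      (Set.toFinite _)
    refine hcon (ih (q.concat hvz) hq' hqK' hy' ?_ (by lia) hbig')
    obtain ⟨p, hp⟩ : z ∈ avoidComp G (S ∪ {z | z ∈ q.support}) w := by
      rwa [avoidComp_eq_of_mem hwL]
    obtain ⟨u, hu, b, hb, hbp, hbu⟩ := exists_adj_mem_avoidComp p
      (notMem_of_mem_avoidComp hwL') (Or.inr (by simp))
    have hbz : b = z := by
      rw [hsupp] at hb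
      exact hb.resolve_right (hp b hbp)
    subst hbz
    exact ⟨u, avoidComp_eq_of_mem hwL' ▸ hu, hbu⟩

/-- A component left by `S` has a path which starts in `S` and leaves only pieces of at most half
the size of the component. -/
theorem exists_isPath_halving [Finite V] (hG : G.Connected) (hS : S.Nonempty) (hx : x ∉ S) :
    ∃ a ∈ S, ∃ (v : V) (q : G.Walk a v), q.IsPath ∧
      (∀ z ∈ q.support, z ∈ avoidComp G S x ∪ S) ∧
      ∀ y ∈ avoidComp G S x, y ∉ q.support →
        2 * (avoidComp G (S ∪ {z | z ∈ q.support}) y).ncard ≤ (avoidComp G S x).ncard := by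
  obtain ⟨s, hs⟩ := hS
  obtain ⟨p⟩ := hG.preconnected x s
  obtain ⟨u, hu, a, ha, -, hau⟩ := exists_adj_mem_avoidComp p hx hs
  have hSa : S ∪ {z | z ∈ (Walk.nil : G.Walk a a).support} = S := by
    simpa using ha
  have hpos : 0 < (avoidComp G S x).ncard :=
    (Set.ncard_pos (Set.toFinite _)).2 ⟨x, self_mem_avoidComp hx⟩
  refine ⟨a, ha, exists_isPath_extend_halving (y := x) _ Walk.nil (by simp) ?_
    (self_mem_avoidComp hx) ?_ le_rfl ?_⟩
  · simpa using Or.inr ha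
  · exact ⟨u, by rwa [hSa], hau⟩
  · rw [hSa]; lia

end Separation

section Halving

open SimpleGraph

variable {G : SimpleGraph V} {S S' : Set V} {B : Set (Sym2 V)} {e₀ : Sym2 V} {d : ℕ}

theorem IsPathBetween.mono {P : Set V} (h : IsPathBetween G S P) (hS : S ⊆ S') :
    IsPathBetween G S' P := by
  obtain ⟨a, ha, b, hb, h⟩ := h
  exact ⟨a, hS ha, b, hS hb, h⟩

theorem isTreeOn_pair {a b : V} (hab : G.Adj a b) : IsTreeOn G {b, a} {s(a, b)} := by
  have h : IsTreeOn G {a} ∅ :=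
    ⟨Set.empty_subset _, by simp, by simp, by rintro x rfl y rfl; exact Reachable.refl _⟩
  have hba := hab.ne'
  simpa using h.insert_leaf rfl hba hab

/-- Increasing the distances by two, a tree can be extended so as to halve the size of the
components outside of it. -/
theorem IsTreeOn.exists_halving [Finite V] (hG : G.Connected)
    (h2 : ∀ v : V, (G.induce {w | w ≠ v}).Connected) (hS : S.Nontrivial) (h : IsTreeOn G S B)
    (hd : ∀ e ∈ B, FundDistLE G B e₀ d e) {j : ℕ}
    (hj : ∀ x ∉ S, (avoidComp G S x).ncard < 2 ^ (j + 1)) :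
    ∃ S' B', S ⊆ S' ∧ IsTreeOn G S' B' ∧ (∀ e ∈ B', FundDistLE G B' e₀ (d + 2) e) ∧
      ∀ x ∉ S', (avoidComp G S' x).ncard < 2 ^ j := by
  have hfin : {K | ∃ x, x ∉ S ∧ avoidComp G S x = K}.Finite := Set.toFinite _
  set t := hfin.toFinset with ht
  have key : ∀ K ∈ t, ∃ E Q : Set V, IsPathBetween G S E ∧ IsPathBetween G (S ∪ E) Q ∧
      E ⊆ K ∪ S ∧ Q ⊆ K ∪ S ∧
      ∀ y ∈ K, y ∉ Q → 2 * (avoidComp G (S ∪ Q) y).ncard ≤ K.ncard := by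
    intro K hK
    rw [ht, hfin.mem_toFinset] at hK
    obtain ⟨x, hx, rfl⟩ := hK
    obtain ⟨a, ha, v, q, hq, hqK, hhalf⟩ := exists_isPath_halving hG hS.nonempty hx
    obtain ⟨E, hE, hvE, hEK⟩ := exists_isPathBetween_of_walk (x := x) h2 hS q
      ⟨{a}, ⟨a, ha, a, ha, Walk.nil, by simp, by ext; simp⟩, rfl, by
        rintro _ rfl; exact Or.inr ha⟩ hqK
    exact ⟨E, {z | z ∈ q.support}, hE, ⟨a, Or.inl ha, v, Or.inr hvE, q, hq, rfl⟩, hEK, hqK,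
      hhalf⟩
  choose! E Q hE hQ hEK hQK hhalf using key
  have hdisj : ∀ K ∈ t, ∀ K' ∈ t, K ≠ K' → (K ∪ S) ∩ (K' ∪ S) ⊆ S := by
    rintro K hK K' hK' hne z ⟨hz | hz, hz' | hz'⟩
    · rw [ht, hfin.mem_toFinset] at hK hK'
      obtain ⟨x, hx, rfl⟩ := hK
      obtain ⟨x', hx', rfl⟩ := hK'
      exact absurd ((avoidComp_eq_of_mem hz).symm.trans (avoidComp_eq_of_mem hz')) hne
    all_goals assumption
  obtain ⟨B₁, hB₁, hT₁, hd₁⟩ := h.exists_biUnion_paths hd t E hE fun K hK K' hK' hne =>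
    (Set.inter_subset_inter (hEK K hK) (hEK K' hK')).trans (hdisj K hK K' hK' hne)
  obtain ⟨B₂, hB₂, hT₂, hd₂⟩ := hT₁.exists_biUnion_paths hd₁ t Q
    (fun K hK => (hQ K hK).mono
      (Set.union_subset_union_right _ (Set.subset_biUnion_of_mem (u := E) hK)))
    fun K hK K' hK' hne => ((Set.inter_subset_inter (hQK K hK) (hQK K' hK')).trans
      (hdisj K hK K' hK' hne)).trans Set.subset_union_left
  have hSS : S ⊆ S ∪ ⋃ K ∈ t, E K := Set.subset_union_left
  refine ⟨_, B₂, hSS.trans Set.subset_union_left, hT₂, hd₂, fun x hx => ?_⟩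
  have hxS : x ∉ S := fun hxS => hx (Or.inl (Or.inl hxS))
  have hKt : avoidComp G S x ∈ t := by
    rw [ht, hfin.mem_toFinset]
    exact ⟨x, hxS, rfl⟩
  have hQt : Q (avoidComp G S x) ⊆ ⋃ K ∈ t, Q K := Set.subset_biUnion_of_mem (u := Q) hKt
  have h1 := hhalf _ hKt x (self_mem_avoidComp hxS) fun hxQ => hx (Or.inr (hQt hxQ))
  have h3 := Set.ncard_le_ncard (avoidComp_anti (G := G) (x := x)
    (Set.union_subset_union hSS hQt)) (Set.toFinite _)
  have h4 := hj x hxS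
  rw [pow_succ] at h4
  lia

theorem IsTreeOn.exists_univ [Finite V] (hG : G.Connected)
    (h2 : ∀ v : V, (G.induce {w | w ≠ v}).Connected) (j : ℕ) :
    ∀ {S : Set V} {B : Set (Sym2 V)} {d : ℕ}, S.Nontrivial → IsTreeOn G S B →
    (∀ e ∈ B, FundDistLE G B e₀ d e) → (∀ x ∉ S, (avoidComp G S x).ncard < 2 ^ j) →
    ∃ B', IsTreeOn G Set.univ B' ∧ ∀ e ∈ B', FundDistLE G B' e₀ (d + 2 * j) e := by
  induction j with
  | zero =>
    intro S B d _ h hd hj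
    obtain rfl : S = Set.univ := by
      refine Set.eq_univ_of_forall fun x => ?_
      by_contra hx
      have := (Set.ncard_pos (Set.toFinite _)).2 ⟨x, self_mem_avoidComp (G := G) hx⟩
      have := hj x hx
      lia
    exact ⟨B, h, by simpa using hd⟩
  | succ j ih =>
    intro S B d hS h hd hj
    obtain ⟨S', B', hSS', h', hd', hj'⟩ := h.exists_halving hG h2 hS hd hj
    obtain ⟨B'', h'', hd''⟩ := ih (hS.mono hSS') h' hd' hj'
    refine ⟨B'', h'', ?_⟩
    convert! hd'' using 3
    lia

theorem exists_isTreeOn_univ_fundDistLE [Fintype V] (hG : G.Connected)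
    (h2 : ∀ v : V, (G.induce {w | w ≠ v}).Connected) (hV : Nontrivial V) :
    ∃ (B : Set (Sym2 V)) (e₀ : Sym2 V), e₀ ∈ G.edgeSet ∧ IsTreeOn G Set.univ B ∧
      ∀ e ∈ B, FundDistLE G B e₀ (2 * (Nat.log 2 (Fintype.card V) + 1)) e := by
  obtain ⟨a⟩ := hG.nonempty
  obtain ⟨b, hab⟩ := hG.preconnected.exists_adj_of_nontrivial a
  obtain ⟨B, hB, hd⟩ := IsTreeOn.exists_univ (e₀ := s(a, b)) (d := 0) hG h2
    (Nat.log 2 (Fintype.card V) + 1) (Set.nontrivial_pair hab.ne') (isTreeOn_pair hab)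
    (by rintro e rfl; exact .base 0) (fun x _ => by
      refine lt_of_le_of_lt ?_ (Nat.lt_pow_succ_log_self (by norm_num) _)
      rw [← Nat.card_eq_fintype_card]
      exact Set.ncard_le_card _)
  exact ⟨B, s(a, b), hab, hB, by simpa using hd⟩

end Halving

/-- There is an absolute constant `c` such that every 2-connected graph
on `n` vertices has a spanning tree `B` whose fundamental graph `S_B` is connected and has
diameter at most `c·log n` (i.e., all pairwise distances in `S_B` are at most `c·log n`). -/
theorem exists_spanning_tree_log_diameter_fundamental_graph :
    ∃ c : ℕ, ∀ (V : Type u) [Fintype V] (G : SimpleGraph V), TwoConnected G →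
      ∃ B : Set (Sym2 V), IsSpanningTreeOf G B ∧ (treeFundGraph G B).Connected ∧
        ∀ x y : ↥G.edgeSet, (treeFundGraph G B).dist x y ≤ c * Nat.log 2 (Fintype.card V) := by
  refine ⟨18, fun V _ G hG => ?_⟩
  obtain ⟨hcard, hconn, h2⟩ := hG
  obtain ⟨B, e₀, he₀, hB, hd⟩ := exists_isTreeOn_univ_fundDistLE hconn h2
    (Fintype.one_lt_card_iff_nontrivial.1 (by lia))
  have hlog : 1 ≤ Nat.log 2 (Fintype.card V) := Nat.log_pos (by norm_num) (by lia)
  have hwalk := hB.exists_walk hd he₀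
  refine ⟨B, ⟨hB.subset_edgeSet, ?_, hB.isAcyclic⟩, ?_, fun x y => ?_⟩
  · have := hconn.nonempty
    exact ⟨fun x y => hB.reachable x trivial y trivial⟩
  · exact (SimpleGraph.connected_iff_exists_forall_reachable _).2
      ⟨⟨e₀, he₀⟩, fun f => (hwalk f).choose.reachable⟩
  · obtain ⟨p, hp⟩ := hwalk x
    obtain ⟨q, hq⟩ := hwalk y
    refine (SimpleGraph.dist_le (p.reverse.append q)).trans ?_
    rw [SimpleGraph.Walk.length_append, SimpleGraph.Walk.length_reverse]
    lia
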